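/- arXiv:1406.5378 — 3 statements merged into one kernel-verified Lean document; each statement's English description precedes it below -/
import Mathlib

section
/- Let X = {x_0, x_1, …, x_m}. On ℝ^m⟨⟨X⟩⟩ define the product c ⊚ d := d + c ∘̃ d (so that (δ + c) ∘ (δ + d) = δ + c ⊚ d for the corresponding δ-series). Then (ℝ^m⟨⟨X⟩⟩, ⊚) is a group: ⊚ is associative, the zero series is a two-sided identity, and every c ∈ ℝ^m⟨⟨X⟩⟩ has a two-sided inverse c^{-1} characterized by c^{-1} = (−c) ∘̃ c^{-1} and c = (−c^{-1}) ∘̃ c. -/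
open scoped BigOperators

/-- A word over the alphabet `X = {x_0, x_1, …, x_m}`. -/
abbrev Word (m : ℕ) := List (Fin (m+1))

/-- A formal power series in `ℝ⟨⟨X⟩⟩`. -/
abbrev Series (m : ℕ) := Word m → ℝ

/-- A formal power series in `ℝ^l⟨⟨X⟩⟩`. -/
abbrev SeriesVec (l m : ℕ) := Fin l → Series m

/-- The shuffle product on `ℝ⟨⟨X⟩⟩`, defined via the coefficient recursion
`(c ⧢ d, x_i η) = (c^{x_i} ⧢ d, η) + (c ⧢ d^{x_i}, η)` which is the bilinear
extension of `(x_i η) ⧢ (x_j ξ) = x_i (η ⧢ (x_j ξ)) + x_j ((x_i η) ⧢ ξ)`. -/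
def shuffle {m : ℕ} : Series m → Series m → Series m
  | c, d, [] => c [] * d []
  | c, d, i :: η => shuffle (fun w => c (i :: w)) d η + shuffle c (fun w => d (i :: w)) η

/-- `x_ℓ c` : prepend the letter `x_ℓ` to every word of `c`. -/
def prepend {m : ℕ} (ℓ : Fin (m+1)) (c : Series m) : Series m
  | [] => 0
  | j :: w => if j = ℓ then c w else 0

/-- The left quotient `c^{x_ℓ}` : `(c^{x_ℓ}, η) = (c, x_ℓ η)`. -/
def leftQuot {m : ℕ} (ℓ : Fin (m+1)) (c : Series m) : Series m :=
  fun w => c (ℓ :: w)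

/-- The series `1∅`. -/
def oneSeries {m : ℕ} : Series m := fun w => if w = [] then 1 else 0

/-- The constant series `K∅`. -/
def constSeries {m : ℕ} (K : ℝ) : Series m := fun w => if w = [] then K else 0

/-- The component `d_ℓ` of `d ∈ ℝ^m⟨⟨X⟩⟩` indexed by letters, with `d_0 := 0`. -/
def dhat {m : ℕ} (d : Fin m → Series m) (ℓ : Fin (m+1)) : Series m :=
  Fin.cases (motive := fun _ => Series m) 0 d ℓ

/-- The component `d_ℓ` of `d ∈ ℝ^m⟨⟨X⟩⟩` indexed by letters, with `d_0 := 1`. -/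
def dtil {m : ℕ} (d : Fin m → Series m) (ℓ : Fin (m+1)) : Series m :=
  Fin.cases (motive := fun _ => Series m) oneSeries d ℓ

/-- `φ_d(x_ℓ)(e) = x_ℓ e + x_0 (d_ℓ ⧢ e)` with `d_0 := 0`. -/
def phiLetter {m : ℕ} (d : Fin m → Series m) (ℓ : Fin (m+1)) (e : Series m) : Series m :=
  prepend ℓ e + prepend 0 (shuffle (dhat d ℓ) e)

/-- `φ_d(η)` for a word `η`, with `φ_d(∅) = id` and `φ_d(x_ℓ η) = φ_d(x_ℓ) ∘ φ_d(η)`. -/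
def phi {m : ℕ} (d : Fin m → Series m) : Word m → Series m → Series m
  | [], e => e
  | ℓ :: η, e => phiLetter d ℓ (phi d η e)

/-- The modified composition product `c ∘̃ d = Σ_{η ∈ X*} (c, η) φ_d(η)(1)`.
Since `φ_d(η)(1)` has no words of length `< |η|`, the coefficient of a word `ν`
is given by the (finite) sum over all words `η` with `|η| ≤ |ν|`. -/
def modComp {m : ℕ} (c : Series m) (d : Fin m → Series m) : Series m :=
  fun ν => ∑ k ∈ Finset.range (ν.length + 1), ∑ η : Fin k → Fin (m+1),
    c (List.ofFn η) * phi d (List.ofFn η) oneSeries ν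

/-- The modified composition product on `ℝ^l⟨⟨X⟩⟩`, componentwise. -/
def modCompVec {l m : ℕ} (c : SeriesVec l m) (d : SeriesVec m m) : SeriesVec l m :=
  fun i => modComp (c i) d

/-- `ψ_d(x_ℓ)(e) = x_0 (d_ℓ ⧢ e)` with `d_0 := 1`. -/
def psiLetter {m : ℕ} (d : Fin m → Series m) (ℓ : Fin (m+1)) (e : Series m) : Series m :=
  prepend 0 (shuffle (dtil d ℓ) e)

/-- `ψ_d(η)` for a word `η`, with `ψ_d(∅) = id` and `ψ_d(x_ℓ η) = ψ_d(x_ℓ) ∘ ψ_d(η)`. -/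
def psi {m : ℕ} (d : Fin m → Series m) : Word m → Series m → Series m
  | [], e => e
  | ℓ :: η, e => psiLetter d ℓ (psi d η e)

/-- The composition product `c ∘ d = Σ_{η ∈ X*} (c, η) ψ_d(η)(1)`. -/
def comp {m : ℕ} (c : Series m) (d : Fin m → Series m) : Series m :=
  fun ν => ∑ k ∈ Finset.range (ν.length + 1), ∑ η : Fin k → Fin (m+1),
    c (List.ofFn η) * psi d (List.ofFn η) oneSeries ν

/-- The composition product on `ℝ^l⟨⟨X⟩⟩`, componentwise. -/
def compVec {l m : ℕ} (c : SeriesVec l m) (d : SeriesVec m m) : SeriesVec l m :=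
  fun i => comp (c i) d

/-- The group product `c ⊚ d := d + c ∘̃ d` of the output feedback group,
so that `(δ + c) ∘ (δ + d) = δ + c ⊚ d`. -/
def oplus {m : ℕ} (c d : SeriesVec m m) : SeriesVec m m :=
  d + modCompVec c d

section Shuffle

variable {m : ℕ}

lemma shuffle_cons (a b : Series m) (i : Fin (m+1)) (w : Word m) :
    shuffle a b (i :: w) = shuffle (leftQuot i a) b w + shuffle a (leftQuot i b) w := rfl

lemma leftQuot_add (i : Fin (m+1)) (a b : Series m) :
    leftQuot i (a + b) = leftQuot i a + leftQuot i b := rfl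

lemma leftQuot_shuffle (i : Fin (m+1)) (a b : Series m) :
    leftQuot i (shuffle a b) = shuffle (leftQuot i a) b + shuffle a (leftQuot i b) := rfl

lemma shuffle_comm (a b : Series m) : shuffle a b = shuffle b a := by
  funext w
  induction w generalizing a b with
  | nil => simp [shuffle, mul_comm]
  | cons i w ih => rw [shuffle_cons, shuffle_cons, ih, ih a, add_comm]

lemma shuffle_add (a b c : Series m) : shuffle a (b + c) = shuffle a b + shuffle a c := by
  funext w
  induction w generalizing a b c with
  | nil => simp [shuffle, mul_add]
  | cons i w ih =>
    simp only [Pi.add_apply] at ih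
    simp only [shuffle_cons, leftQuot_add, Pi.add_apply, ih]
    ring

lemma shuffle_smul (r : ℝ) (a b : Series m) : shuffle a (r • b) = r • shuffle a b := by
  funext w
  induction w generalizing a b with
  | nil => simp [shuffle, mul_left_comm]
  | cons i w ih =>
    simp only [Pi.smul_apply, smul_eq_mul] at ih
    have h : leftQuot i (r • b) = r • leftQuot i b := rfl
    simp only [shuffle_cons, h, Pi.smul_apply, smul_eq_mul, ih]
    ring

/-- Shuffling with a fixed series on the left, as a linear map. -/
def shuffleLinear (a : Series m) : Series m →ₗ[ℝ] Series m where
  toFun := shuffle a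
  map_add' := shuffle_add a
  map_smul' r b := shuffle_smul r a b

lemma shuffle_zero (a : Series m) : shuffle a 0 = 0 := (shuffleLinear a).map_zero

lemma zero_shuffle (a : Series m) : shuffle 0 a = 0 := by rw [shuffle_comm, shuffle_zero]

lemma add_shuffle (a b c : Series m) : shuffle (a + b) c = shuffle a c + shuffle b c := by
  rw [shuffle_comm, shuffle_add, shuffle_comm c a, shuffle_comm c b]

lemma shuffle_sum {ι : Type*} (s : Finset ι) (a : Series m) (f : ι → Series m) :
    shuffle a (∑ j ∈ s, f j) = ∑ j ∈ s, shuffle a (f j) := map_sum (shuffleLinear a) f s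

lemma sum_shuffle {ι : Type*} (s : Finset ι) (a : Series m) (f : ι → Series m) :
    shuffle (∑ j ∈ s, f j) a = ∑ j ∈ s, shuffle (f j) a := by
  simp only [shuffle_comm _ a, shuffle_sum]

lemma shuffle_assoc (a b c : Series m) : shuffle (shuffle a b) c = shuffle a (shuffle b c) := by
  funext w
  induction w generalizing a b c with
  | nil => simp [shuffle, mul_assoc]
  | cons i w ih =>
    simp only [shuffle_cons, leftQuot_shuffle, add_shuffle, shuffle_add, Pi.add_apply, ih]
    ring

lemma shuffle_left_comm (a b c : Series m) :
    shuffle a (shuffle b c) = shuffle b (shuffle a c) := by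
  rw [← shuffle_assoc, shuffle_comm a b, shuffle_assoc]

/-- A coefficient of a shuffle only depends on the coefficients of words which are not longer. -/
lemma shuffle_congr {a a' b b' : Series m} (w : Word m)
    (ha : ∀ v : Word m, v.length ≤ w.length → a v = a' v)
    (hb : ∀ v : Word m, v.length ≤ w.length → b v = b' v) :
    shuffle a b w = shuffle a' b' w := by
  induction w generalizing a a' b b' with
  | nil => simp [shuffle, ha [] le_rfl, hb [] le_rfl]
  | cons i w ih =>
    have shift : ∀ {x y : Series m},
        (∀ v : Word m, v.length ≤ (i :: w).length → x v = y v) →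
        ∀ v : Word m, v.length ≤ w.length → leftQuot i x v = leftQuot i y v :=
      fun h v hv => h (i :: v) (by simpa using hv)
    have weaken : ∀ {x y : Series m},
        (∀ v : Word m, v.length ≤ (i :: w).length → x v = y v) →
        ∀ v : Word m, v.length ≤ w.length → x v = y v :=
      fun h v hv => h v (hv.trans (by simp))
    rw [shuffle_cons, shuffle_cons, ih (shift ha) (weaken hb), ih (weaken ha) (shift hb)]

end Shuffle

section ModComp

variable {m : ℕ}

/-- Prepending a letter, as a linear map. -/
def prependLinear (ℓ : Fin (m+1)) : Series m →ₗ[ℝ] Series m where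
  toFun := prepend ℓ
  map_add' a b := by
    funext w
    cases w with
    | nil => simp [prepend]
    | cons j w => by_cases h : j = ℓ <;> simp [prepend, h]
  map_smul' r a := by
    funext w
    cases w with
    | nil => simp [prepend]
    | cons j w => by_cases h : j = ℓ <;> simp [prepend, h]

/-- The operator `φ_d(x_ℓ)`, as a linear map. -/
def phiLetterLinear (d : Fin m → Series m) (ℓ : Fin (m+1)) : Series m →ₗ[ℝ] Series m :=
  prependLinear ℓ + prependLinear 0 ∘ₗ shuffleLinear (dhat d ℓ)

lemma phiLetterLinear_apply (d : Fin m → Series m) (ℓ : Fin (m+1)) (e : Series m) :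
    phiLetterLinear d ℓ e = phiLetter d ℓ e := rfl

lemma phi_one_eq_zero (d : Fin m → Series m) (η w : Word m) (h : w.length < η.length) :
    phi d η oneSeries w = 0 := by
  induction η generalizing w with
  | nil => simp at h
  | cons ℓ η ih =>
    cases w with
    | nil => simp [phi, phiLetter, prepend]
    | cons j w =>
      have hw : w.length < η.length := by simpa using h
      have hs : shuffle (dhat d ℓ) (phi d η oneSeries) w = 0 := by
        rw [shuffle_congr (a' := dhat d ℓ) (b' := 0) w (fun _ _ => rfl)
          (fun v hv => ih v (hv.trans_lt hw)), shuffle_zero, Pi.zero_apply]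
      simp [phi, phiLetter, prepend, ih w hw, hs]

/-- The partial sum of `c ∘̃ d` over the words of length less than `N`. -/
def modCompTrunc (N : ℕ) (c : Series m) (d : Fin m → Series m) : Series m :=
  ∑ k ∈ Finset.range N, ∑ η : Fin k → Fin (m+1),
    c (List.ofFn η) • phi d (List.ofFn η) oneSeries

lemma modCompTrunc_apply (N : ℕ) (c : Series m) (d : Fin m → Series m) (w : Word m)
    (h : w.length < N) : modCompTrunc N c d w = modComp c d w := by
  simp only [modCompTrunc, modComp, Finset.sum_apply, Pi.smul_apply, smul_eq_mul]
  symm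
  refine Finset.sum_subset (Finset.range_mono h) fun k _ hk => Finset.sum_eq_zero fun η _ => ?_
  rw [phi_one_eq_zero, mul_zero]
  simpa using hk

lemma modCompTrunc_succ (N : ℕ) (c : Series m) (d : Fin m → Series m) :
    modCompTrunc (N + 1) c d
      = c [] • oneSeries + ∑ j, phiLetter d j (modCompTrunc N (leftQuot j c) d) := by
  have hk : ∀ k : ℕ, ∑ η : Fin (k + 1) → Fin (m+1),
        c (List.ofFn η) • phi d (List.ofFn η) oneSeries
      = ∑ j, ∑ η : Fin k → Fin (m+1),
        leftQuot j c (List.ofFn η) • phiLetter d j (phi d (List.ofFn η) oneSeries) := by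
    intro k
    rw [← (Fin.consEquiv fun _ : Fin (k + 1) => Fin (m+1)).sum_comp, Fintype.sum_prod_type]
    simp [Fin.consEquiv, List.ofFn_succ, phi, leftQuot]
  rw [modCompTrunc, Finset.sum_range_succ']
  simp only [hk]
  rw [Finset.sum_comm, add_comm]
  congr 1
  · simp [phi]
  · simp only [modCompTrunc, ← phiLetterLinear_apply, map_sum, map_smul]

lemma modComp_nil (c : Series m) (d : Fin m → Series m) : modComp c d [] = c [] := by
  simp [modComp, phi, oneSeries]

/-- The series `Σ_j d_j ⧢ (c^{x_j} ∘̃ d)`, the contribution of `d` to the left quotient of `c ∘̃ d`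
by `x_0`. -/
def modCompCorrection (c : Series m) (d : Fin m → Series m) : Series m :=
  ∑ j, shuffle (dhat d j) (modComp (leftQuot j c) d)

lemma leftQuot_modComp (i : Fin (m+1)) (c : Series m) (d : Fin m → Series m) :
    leftQuot i (modComp c d)
      = modComp (leftQuot i c) d + if i = 0 then modCompCorrection c d else 0 := by
  funext w
  have hs : ∀ j, shuffle (dhat d j) (modCompTrunc (w.length + 1) (leftQuot j c) d) w
      = shuffle (dhat d j) (modComp (leftQuot j c) d) w := fun j =>
    shuffle_congr w (fun _ _ => rfl)
      (fun v hv => modCompTrunc_apply _ _ _ _ (Nat.lt_succ_of_le hv))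
  have hj : ∀ j, phiLetter d j (modCompTrunc (w.length + 1) (leftQuot j c) d) (i :: w)
      = (if i = j then modComp (leftQuot j c) d w else 0)
        + if i = 0 then shuffle (dhat d j) (modComp (leftQuot j c) d) w else 0 := by
    intro j
    simp only [phiLetter, Pi.add_apply, prepend, hs, modCompTrunc_apply _ _ _ w (Nat.lt_succ_self _)]
  change modComp c d (i :: w) = _
  rw [← modCompTrunc_apply (w.length + 1 + 1) c d (i :: w) (by simp), modCompTrunc_succ]
  simp only [Pi.add_apply, Finset.sum_apply, hj, Finset.sum_add_distrib]
  by_cases h : i = 0 <;> simp [h, oneSeries, modCompCorrection, Finset.sum_apply]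

lemma modComp_cons (i : Fin (m+1)) (c : Series m) (d : Fin m → Series m) (w : Word m) :
    modComp c d (i :: w)
      = modComp (leftQuot i c) d w + if i = 0 then modCompCorrection c d w else 0 := by
  have h := congrFun (leftQuot_modComp i c d) w
  by_cases hi : i = 0 <;> simpa [leftQuot, hi] using h

lemma modComp_add (a b : Series m) (d : Fin m → Series m) :
    modComp (a + b) d = modComp a d + modComp b d := by
  funext w
  simp [modComp, add_mul, Finset.sum_add_distrib]

lemma modComp_neg (a : Series m) (d : Fin m → Series m) : modComp (-a) d = -modComp a d := by
  funext w
  simp [modComp]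

lemma zero_modComp (d : Fin m → Series m) : modComp 0 d = 0 := by
  funext w
  simp [modComp]

lemma modComp_sum {ι : Type*} (s : Finset ι) (f : ι → Series m) (d : Fin m → Series m) :
    modComp (∑ j ∈ s, f j) d = ∑ j ∈ s, modComp (f j) d :=
  map_sum (AddMonoidHom.mk' (fun a : Series m => modComp a d) fun a b => modComp_add a b d) f s

lemma dhat_zero_right (d : Fin m → Series m) : dhat d 0 = 0 := rfl

lemma dhat_zero (j : Fin (m+1)) : dhat (0 : Fin m → Series m) j = 0 := by
  cases j using Fin.cases <;> rfl

lemma modComp_zero (c : Series m) : modComp c 0 = c := by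
  funext w
  induction w generalizing c with
  | nil => exact modComp_nil c 0
  | cons i w ih =>
    rw [modComp_cons, ih]
    simp [modCompCorrection, dhat_zero, zero_shuffle, leftQuot]

/-- `∘̃ e` is a homomorphism for the shuffle product. -/
lemma modComp_shuffle (a b : Series m) (e : Fin m → Series m) :
    modComp (shuffle a b) e = shuffle (modComp a e) (modComp b e) := by
  suffices H : ∀ (n : ℕ) (a b : Series m) (w : Word m), w.length < n →
      modComp (shuffle a b) e w = shuffle (modComp a e) (modComp b e) w from
    funext fun w => H _ a b w (Nat.lt_succ_self _)
  intro n
  induction n with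
  | zero => intro a b w h; simp at h
  | succ n ih =>
    intro a b w hw
    cases w with
    | nil => simp [modComp_nil, shuffle]
    | cons i w =>
      have hwn : w.length < n := by simpa using hw
      have hc : modCompCorrection (shuffle a b) e w
          = shuffle (modCompCorrection a e) (modComp b e) w
            + shuffle (modComp a e) (modCompCorrection b e) w := by
        simp only [modCompCorrection, sum_shuffle, shuffle_sum, Finset.sum_apply,
          ← Finset.sum_add_distrib]
        refine Finset.sum_congr rfl fun j _ => ?_
        rw [shuffle_congr (a' := dhat e j)
          (b' := shuffle (modComp (leftQuot j a) e) (modComp b e)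
            + shuffle (modComp a e) (modComp (leftQuot j b) e)) w (fun _ _ => rfl) ?_]
        · rw [shuffle_add, shuffle_assoc, shuffle_left_comm (dhat e j) (modComp a e), Pi.add_apply]
        · intro v hv
          rw [leftQuot_shuffle, modComp_add, Pi.add_apply, ih _ _ v (hv.trans_lt hwn),
            ih _ _ v (hv.trans_lt hwn), Pi.add_apply]
      rw [modComp_cons, leftQuot_shuffle, modComp_add, Pi.add_apply, ih _ _ w hwn, ih _ _ w hwn,
        shuffle_cons, leftQuot_modComp, leftQuot_modComp, hc]
      by_cases hi : i = 0
      · simp only [hi, if_true, add_shuffle, shuffle_add, Pi.add_apply]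
        ring
      · simp [hi]

lemma dhat_oplus (d e : SeriesVec m m) (j : Fin (m+1)) :
    dhat (oplus d e) j = dhat e j + modComp (dhat d j) e := by
  cases j using Fin.cases with
  | zero => simp [dhat_zero_right, zero_modComp]
  | succ j => rfl

/-- Mixed associativity of `∘̃` with the group product. -/
lemma modComp_modComp (c : Series m) (d e : SeriesVec m m) :
    modComp (modComp c d) e = modComp c (oplus d e) := by
  suffices H : ∀ (n : ℕ) (c : Series m) (w : Word m), w.length < n →
      modComp (modComp c d) e w = modComp c (oplus d e) w from
    funext fun w => H _ c w (Nat.lt_succ_self _)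
  intro n
  induction n with
  | zero => intro c w h; simp at h
  | succ n ih =>
    intro c w hw
    cases w with
    | nil => simp [modComp_nil]
    | cons i w =>
      have hwn : w.length < n := by simpa using hw
      have he : ∀ j, shuffle (dhat e j) (modComp (leftQuot j (modComp c d)) e)
          = shuffle (dhat e j) (modComp (modComp (leftQuot j c) d) e) := by
        intro j
        by_cases hj : j = 0
        · rw [hj, dhat_zero_right, zero_shuffle, zero_shuffle]
        · rw [leftQuot_modComp, if_neg hj, add_zero]
      have hc : modComp (modCompCorrection c d) e w + modCompCorrection (modComp c d) e w
          = modCompCorrection c (oplus d e) w := by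
        simp only [modCompCorrection, modComp_sum, modComp_shuffle, he, Finset.sum_apply,
          ← Finset.sum_add_distrib]
        refine Finset.sum_congr rfl fun j _ => ?_
        rw [add_comm, ← Pi.add_apply, ← add_shuffle, ← dhat_oplus]
        exact shuffle_congr w (fun _ _ => rfl) fun v hv => ih _ v (hv.trans_lt hwn)
      rw [modComp_cons, leftQuot_modComp, modComp_cons, modComp_add, Pi.add_apply, ih _ w hwn]
      by_cases hi : i = 0
      · simp only [hi, if_true, add_assoc, hc]
      · simp [hi, zero_modComp]

/-- `c ∘̃ ·` is contractive: agreement of the arguments on words of length less than `n` gives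
agreement of the values on words of length at most `n`. -/
lemma modComp_congr {d d' : Fin m → Series m} {n : ℕ}
    (h : ∀ i, ∀ v : Word m, v.length < n → d i v = d' i v) (c : Series m) (w : Word m)
    (hw : w.length < n + 1) : modComp c d w = modComp c d' w := by
  induction n generalizing c w with
  | zero =>
    obtain rfl : w = [] := List.length_eq_zero_iff.mp (by omega)
    rw [modComp_nil, modComp_nil]
  | succ n ih =>
    have ih' := ih fun i v hv => h i v (hv.trans (Nat.lt_succ_self n))
    cases w with
    | nil => rw [modComp_nil, modComp_nil]
    | cons i w =>
      have hwn : w.length < n + 1 := by simpa using hw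
      have hd : ∀ j, ∀ v : Word m, v.length < n + 1 → dhat d j v = dhat d' j v := by
        intro j
        cases j using Fin.cases with
        | zero => exact fun _ _ => rfl
        | succ j => exact h j
      have hc : modCompCorrection c d w = modCompCorrection c d' w := by
        simp only [modCompCorrection, Finset.sum_apply]
        exact Finset.sum_congr rfl fun j _ => shuffle_congr w
          (fun v hv => hd j v (hv.trans_lt hwn)) fun v hv => ih' _ v (hv.trans_lt hwn)
      rw [modComp_cons, modComp_cons, ih' _ w hwn, hc]

end ModComp

section Group

variable {m : ℕ}

/-- The contraction `e ↦ c ∘̃ e` has a fixed point. -/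
lemma exists_modCompVec_fixedPoint (c : SeriesVec m m) : ∃ e, modCompVec c e = e := by
  let u : ℕ → SeriesVec m m := fun n => (modCompVec c)^[n] 0
  have hu : ∀ n, u (n + 1) = modCompVec c (u n) := fun n =>
    Function.iterate_succ_apply' (modCompVec c) n 0
  have hstep : ∀ n i, ∀ v : Word m, v.length < n → u n i v = u (n + 1) i v := by
    intro n
    induction n with
    | zero => intro i v hv; simp at hv
    | succ n ih =>
      intro i v hv
      have h : modCompVec c (u n) i v = modCompVec c (u (n + 1)) i v :=
        modComp_congr ih (c i) v hv
      rwa [← hu, ← hu] at h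
  let e : SeriesVec m m := fun i w => u (w.length + 1) i w
  have he : ∀ n i, ∀ v : Word m, v.length < n → e i v = u n i v := by
    intro n i v hv
    induction n, (Nat.succ_le_of_lt hv) using Nat.le_induction with
    | base => rfl
    | succ n hn ih => rw [ih hn, hstep n i v hn]
  refine ⟨e, ?_⟩
  funext i w
  change modComp (c i) e w = u (w.length + 1) i w
  rw [hu]
  exact modComp_congr (he w.length) (c i) w (Nat.lt_succ_self _)

lemma modCompVec_neg (c d : SeriesVec m m) : modCompVec (-c) d = -modCompVec c d :=
  funext fun i => modComp_neg (c i) d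

lemma oplus_assoc (c d e : SeriesVec m m) : oplus (oplus c d) e = oplus c (oplus d e) := by
  funext i
  change e i + modComp (d i + modComp (c i) d) e
    = (e i + modComp (d i) e) + modComp (c i) (oplus d e)
  rw [modComp_add, modComp_modComp, add_assoc]

lemma oplus_zero (c : SeriesVec m m) : oplus c 0 = c := by
  funext i
  simp [oplus, modCompVec, modComp_zero]

lemma zero_oplus (c : SeriesVec m m) : oplus 0 c = c := by
  funext i
  simp [oplus, modCompVec, zero_modComp]

lemma oplus_eq_zero_iff (c d : SeriesVec m m) : oplus c d = 0 ↔ d = modCompVec (-c) d := by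
  rw [oplus, modCompVec_neg, add_eq_zero_iff_eq_neg]

lemma exists_oplus_eq_zero (c : SeriesVec m m) : ∃ d, oplus c d = 0 := by
  obtain ⟨d, hd⟩ := exists_modCompVec_fixedPoint (-c)
  exact ⟨d, (oplus_eq_zero_iff c d).mpr hd.symm⟩

end Group

/-- `(ℝ^m⟨⟨X⟩⟩, ⊚)` with `c ⊚ d = d + c ∘̃ d` is a group: `⊚` is
associative, the zero series is a two-sided identity, and every `c` has a
two-sided inverse `c⁻¹` characterized by `c⁻¹ = (−c) ∘̃ c⁻¹` and
`c = (−c⁻¹) ∘̃ c`. -/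
theorem outputFeedbackGroup (m : ℕ) :
    (∀ c d e : SeriesVec m m, oplus (oplus c d) e = oplus c (oplus d e)) ∧
    (∀ c : SeriesVec m m, oplus c 0 = c ∧ oplus 0 c = c) ∧
    (∀ c : SeriesVec m m, ∃ cinv : SeriesVec m m,
      oplus c cinv = 0 ∧ oplus cinv c = 0 ∧
      cinv = modCompVec (-c) cinv ∧ c = modCompVec (-cinv) c) := by
  refine ⟨oplus_assoc, fun c => ⟨oplus_zero c, zero_oplus c⟩, fun c => ?_⟩
  obtain ⟨d, hd⟩ := exists_oplus_eq_zero c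
  obtain ⟨e, he⟩ := exists_oplus_eq_zero d
  have hce : c = e := by
    rw [← oplus_zero c, ← he, ← oplus_assoc, hd, zero_oplus]
  rw [← hce] at he
  exact ⟨d, hd, he, (oplus_eq_zero_iff c d).mp hd, (oplus_eq_zero_iff d c).mp he⟩
end

section
/- For all c ∈ ℝ^ℓ⟨⟨X⟩⟩, d ∈ ℝ^m⟨⟨X⟩⟩, and every word η ∈ {x_1, …, x_m}* containing no occurrence of the letter x_0, one has (c ∘̃ d, η) = (c, η). Consequently, if c ∈ ℝ^m⟨⟨X⟩⟩ and c^{-1} is its composition inverse (the unique series with c^{-1} = (−c) ∘̃ c^{-1}), then (c_i^{-1}, η) = −(c_i, η) for every x_0-free word η and every i = 1, …, m. -/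
open scoped BigOperators

/-- On words without `x_0`, the series `φ_d(ξ)(1)` agrees with the monomial `ξ`. -/
theorem phi_oneSeries_of_zero_notMem {m : ℕ} (d : Fin m → Series m) (ξ ν : Word m)
    (hν : (0 : Fin (m+1)) ∉ ν) :
    phi d ξ oneSeries ν = if ξ = ν then 1 else 0 := by
  induction ξ generalizing ν with
  | nil => simp [phi, oneSeries, eq_comm]
  | cons j ξ ih =>
    cases ν with
    | nil => simp [phi, phiLetter, prepend]
    | cons k ν =>
      obtain ⟨hk, hν⟩ : ¬ (0 : Fin (m+1)) = k ∧ (0 : Fin (m+1)) ∉ ν := by simpa using hν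
      by_cases hjk : k = j
      · subst hjk
        simp [phi, phiLetter, prepend, Ne.symm hk, ih ν hν]
      · simp [phi, phiLetter, prepend, Ne.symm hk, hjk, Ne.symm hjk]

/-- The modified composition product `c ∘̃ d` has the same coefficients as `c` on words
without `x_0`. -/
theorem modComp_of_zero_notMem {m : ℕ} (c : Series m) (d : Fin m → Series m) (ν : Word m)
    (hν : (0 : Fin (m+1)) ∉ ν) : modComp c d ν = c ν := by
  simp only [modComp, phi_oneSeries_of_zero_notMem d _ ν hν, mul_ite, mul_one, mul_zero]
  rw [Finset.sum_eq_single_of_mem ν.length (by simp), Finset.sum_eq_single ν.get]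
  · simp
  · intro η _ hη
    refine if_neg fun h => hη (List.ofFn_injective ?_)
    rw [h, List.ofFn_get]
  · simp
  · intro k _ hk
    refine Finset.sum_eq_zero fun η _ => if_neg fun h => hk ?_
    rw [← h, List.length_ofFn]

/-- for every word `η` containing no occurrence of `x_0`,
`(c ∘̃ d, η) = (c, η)`; consequently, for the composition inverse `c⁻¹`
(the unique series with `c⁻¹ = (−c) ∘̃ c⁻¹`), `(c_i⁻¹, η) = −(c_i, η)` on all
`x_0`-free words. -/
theorem modComp_x0free_coefficients (l m : ℕ) :
    (∀ (c : SeriesVec l m) (d : SeriesVec m m) (η : Word m),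
      (0 : Fin (m+1)) ∉ η → ∀ i : Fin l, modCompVec c d i η = c i η) ∧
    (∀ (c cinv : SeriesVec m m), cinv = modCompVec (-c) cinv →
      ∀ η : Word m, (0 : Fin (m+1)) ∉ η → ∀ i : Fin m, cinv i η = -(c i η)) := by
  refine ⟨fun c d η hη i => modComp_of_zero_notMem (c i) d η hη,
    fun c cinv h η hη i => ?_⟩
  rw [h]
  exact modComp_of_zero_notMem ((-c) i) cinv η hη
end

section
/- Let c, d ∈ ℝ^m⟨⟨X⟩⟩ and let e ∈ ℝ^m⟨⟨X⟩⟩ be the unique series satisfying e = (d ∘ c) ∘̃ e, i.e., e = (−d ∘ c)^{-1} is the composition inverse of −d ∘ c. Then the series w := c ∘̃ e satisfies the feedback fixed-point equation w = c ∘̃ (d ∘ w). Consequently, the feedback product satisfies c @ d = c ∘̃ (−d ∘ c)^{-1}. -/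
open scoped BigOperators

namespace FeedbackProduct

variable {m : ℕ}

/-! ### The shuffle product -/

lemma shuffle_cons (c d : Series m) (i : Fin (m+1)) (η : Word m) :
    shuffle c d (i :: η) = shuffle (leftQuot i c) d η + shuffle c (leftQuot i d) η := rfl

lemma leftQuot_shuffle (i : Fin (m+1)) (c d : Series m) :
    leftQuot i (shuffle c d) = shuffle (leftQuot i c) d + shuffle c (leftQuot i d) := rfl

/-- The coefficient of `ν` in `c ⧢ d` only involves words of length at most `|ν|`. -/
lemma shuffle_congr {c c' d d' : Series m} {ν : Word m}
    (hc : ∀ ξ : Word m, ξ.length ≤ ν.length → c ξ = c' ξ)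
    (hd : ∀ ξ : Word m, ξ.length ≤ ν.length → d ξ = d' ξ) :
    shuffle c d ν = shuffle c' d' ν := by
  induction ν generalizing c c' d d' with
  | nil => simp [shuffle, hc [] le_rfl, hd [] le_rfl]
  | cons i ν ih =>
    rw [shuffle_cons, shuffle_cons]
    congr 1
    · exact ih (fun ξ hξ => hc (i :: ξ) (by simpa using hξ))
        (fun ξ hξ => hd ξ (by simp only [List.length_cons]; omega))
    · exact ih (fun ξ hξ => hc ξ (by simp only [List.length_cons]; omega))
        (fun ξ hξ => hd (i :: ξ) (by simpa using hξ))

lemma shuffle_comm (c d : Series m) : shuffle c d = shuffle d c := by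
  funext ν
  induction ν generalizing c d with
  | nil => simp [shuffle, mul_comm]
  | cons i ν ih => rw [shuffle_cons, shuffle_cons, ih, ih c, add_comm]

lemma shuffle_add_right (c d d' : Series m) :
    shuffle c (d + d') = shuffle c d + shuffle c d' := by
  funext ν
  induction ν generalizing c d d' with
  | nil => simp [shuffle, mul_add]
  | cons i ν ih =>
    have h : leftQuot i (d + d') = leftQuot i d + leftQuot i d' := rfl
    simp only [Pi.add_apply, shuffle_cons, h, ih]
    ring

lemma shuffle_smul_right (r : ℝ) (c d : Series m) :
    shuffle c (r • d) = r • shuffle c d := by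
  funext ν
  induction ν generalizing c d with
  | nil => simp [shuffle, mul_left_comm]
  | cons i ν ih =>
    have h : leftQuot i (r • d) = r • leftQuot i d := rfl
    simp only [Pi.smul_apply, shuffle_cons, h, ih, smul_add]

lemma shuffle_add_left (c c' d : Series m) :
    shuffle (c + c') d = shuffle c d + shuffle c' d := by
  rw [shuffle_comm, shuffle_add_right, shuffle_comm d, shuffle_comm d]

lemma shuffle_zero_right (c : Series m) : shuffle c 0 = 0 := by
  simpa using shuffle_smul_right 0 c 0

lemma shuffle_zero_left (c : Series m) : shuffle 0 c = 0 := by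
  rw [shuffle_comm, shuffle_zero_right]

lemma shuffle_sum_right {ι : Type*} (s : Finset ι) (c : Series m) (f : ι → Series m) :
    shuffle c (∑ i ∈ s, f i) = ∑ i ∈ s, shuffle c (f i) := by
  classical
  induction s using Finset.induction_on with
  | empty => simp [shuffle_zero_right]
  | insert a s ha ih => rw [Finset.sum_insert ha, Finset.sum_insert ha, shuffle_add_right, ih]

lemma shuffle_sum_left {ι : Type*} (s : Finset ι) (f : ι → Series m) (c : Series m) :
    shuffle (∑ i ∈ s, f i) c = ∑ i ∈ s, shuffle (f i) c := by
  simp only [shuffle_comm _ c, shuffle_sum_right]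

lemma shuffle_assoc (a b c : Series m) :
    shuffle (shuffle a b) c = shuffle a (shuffle b c) := by
  funext ν
  induction ν generalizing a b c with
  | nil => simp [shuffle, mul_assoc]
  | cons i ν ih =>
    simp only [shuffle_cons, leftQuot_shuffle, shuffle_add_left, shuffle_add_right,
      Pi.add_apply, ih]
    ring

lemma shuffle_left_comm (a b c : Series m) :
    shuffle a (shuffle b c) = shuffle b (shuffle a c) := by
  rw [← shuffle_assoc, shuffle_comm a b, shuffle_assoc]

/-! ### Locally finite sums indexed by words -/

/-- The sum `∑_η (c, η) F(η)`, where `F(η)` has no words shorter than `η`. -/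
def wordSum (c : Series m) (F : Word m → Series m) : Series m :=
  fun ν => ∑ k ∈ Finset.range (ν.length + 1), ∑ η : Fin k → Fin (m+1),
    c (List.ofFn η) * F (List.ofFn η) ν

lemma modComp_eq_wordSum (c : Series m) (d : SeriesVec m m) :
    modComp c d = wordSum c (fun η => phi d η oneSeries) := rfl

lemma comp_eq_wordSum (c : Series m) (d : SeriesVec m m) :
    comp c d = wordSum c (fun η => psi d η oneSeries) := rfl

/-- The series `F(η)` has no words shorter than `η`. -/
def IsLocallyFinite (F : Word m → Series m) : Prop :=
  ∀ η ν : Word m, ν.length < η.length → F η ν = 0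

lemma wordSum_eq_of_le {F : Word m → Series m} (hF : IsLocallyFinite F) (c : Series m)
    {ν : Word m} {N : ℕ} (hN : ν.length ≤ N) :
    wordSum c F ν = (∑ k ∈ Finset.range (N + 1), ∑ η : Fin k → Fin (m+1),
      c (List.ofFn η) • F (List.ofFn η)) ν := by
  simp only [Finset.sum_apply, Pi.smul_apply, smul_eq_mul, wordSum]
  refine Finset.sum_subset (Finset.range_mono (by omega)) fun k _ hk => ?_
  refine Finset.sum_eq_zero fun η _ => ?_
  rw [hF _ _ (by simpa using hk), mul_zero]

lemma shuffle_wordSum {F : Word m → Series m} (hF : IsLocallyFinite F) (f c : Series m) :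
    shuffle f (wordSum c F) = wordSum c (fun η => shuffle f (F η)) := by
  funext ν
  rw [shuffle_congr (d' := ∑ k ∈ Finset.range (ν.length + 1), ∑ η : Fin k → Fin (m+1),
    c (List.ofFn η) • F (List.ofFn η)) (fun _ _ => rfl)
    (fun ξ hξ => wordSum_eq_of_le hF c hξ)]
  simp [shuffle_sum_right, shuffle_smul_right, wordSum]

lemma wordSum_add_left (c c' : Series m) (F : Word m → Series m) :
    wordSum (c + c') F = wordSum c F + wordSum c' F := by
  funext ν
  simp [wordSum, add_mul, Finset.sum_add_distrib]

lemma wordSum_zero_left (F : Word m → Series m) : wordSum 0 F = 0 := by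
  funext ν
  simp [wordSum]

lemma wordSum_nil (c : Series m) (F : Word m → Series m) :
    wordSum c F [] = c [] * F [] [] := by
  simp [wordSum]

lemma wordSum_cons (c : Series m) (F : Word m → Series m) (j : Fin (m+1)) (ν : Word m)
    (h : F [] (j :: ν) = 0) :
    wordSum c F (j :: ν) = ∑ ℓ, wordSum (leftQuot ℓ c) (fun η => leftQuot j (F (ℓ :: η))) ν := by
  simp only [wordSum, leftQuot, List.length_cons]
  rw [Finset.sum_range_succ', Finset.sum_comm]
  simp only [List.ofFn_zero, h, mul_zero, Finset.sum_const_zero, add_zero]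
  refine Finset.sum_congr rfl fun k _ => ?_
  rw [← (Fin.consEquiv fun _ : Fin (k + 1) => Fin (m+1)).sum_comp, Fintype.sum_prod_type]
  simp [Fin.consEquiv, List.ofFn_succ]

/-! ### The recursions for the two composition products -/

lemma shuffle_eq_zero_of_length_lt {n : ℕ} {f g : Series m}
    (hg : ∀ ξ : Word m, ξ.length < n → g ξ = 0) {ν : Word m} (hν : ν.length < n) :
    shuffle f g ν = 0 := by
  rw [shuffle_congr (d' := 0) (fun _ _ => rfl) (fun ξ hξ => hg ξ (by omega)), shuffle_zero_right]
  rfl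

lemma isLocallyFinite_phi (d : SeriesVec m m) :
    IsLocallyFinite (fun η => phi d η oneSeries) := by
  intro η
  induction η with
  | nil => simp
  | cons ℓ η ih =>
    rintro (_ | ⟨j, ν⟩) hν
    · simp [phi, phiLetter, prepend]
    · have hν' : ν.length < η.length := by simpa using hν
      simp [phi, phiLetter, prepend, ih ν hν', shuffle_eq_zero_of_length_lt ih hν']

lemma isLocallyFinite_psi (d : SeriesVec m m) :
    IsLocallyFinite (fun η => psi d η oneSeries) := by
  intro η
  induction η with
  | nil => simp
  | cons ℓ η ih =>
    rintro (_ | ⟨j, ν⟩) hν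
    · simp [psi, psiLetter, prepend]
    · have hν' : ν.length < η.length := by simpa using hν
      simp [psi, psiLetter, prepend, shuffle_eq_zero_of_length_lt ih hν']

lemma modComp_nil (c : Series m) (d : SeriesVec m m) : modComp c d [] = c [] := by
  simp [modComp_eq_wordSum, wordSum_nil, phi, oneSeries]

lemma comp_nil (c : Series m) (d : SeriesVec m m) : comp c d [] = c [] := by
  simp [comp_eq_wordSum, wordSum_nil, psi, oneSeries]

lemma wordSum_zero_right (c : Series m) : wordSum c (fun _ => 0) = 0 := by
  funext ν
  simp [wordSum]

lemma leftQuot_prepend (j ℓ : Fin (m+1)) (c : Series m) :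
    leftQuot j (prepend ℓ c) = if j = ℓ then c else 0 := by
  funext ν
  by_cases h : j = ℓ <;> simp [leftQuot, prepend, h]

lemma leftQuot_add (j : Fin (m+1)) (c d : Series m) :
    leftQuot j (c + d) = leftQuot j c + leftQuot j d := rfl

lemma leftQuot_succ_modComp (c : Series m) (d : SeriesVec m m) (i : Fin m) :
    leftQuot i.succ (modComp c d) = modComp (leftQuot i.succ c) d := by
  funext ν
  rw [leftQuot, modComp_eq_wordSum, wordSum_cons _ _ _ _ (by simp [phi, oneSeries]),
    Finset.sum_eq_single i.succ]
  · simp [phi, phiLetter, leftQuot_add, leftQuot_prepend, modComp_eq_wordSum]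
  · intro ℓ _ hℓ
    simp [phi, phiLetter, leftQuot_add, leftQuot_prepend, hℓ.symm, wordSum_zero_right]
  · simp

lemma leftQuot_zero_modComp (c : Series m) (d : SeriesVec m m) :
    leftQuot 0 (modComp c d) = modComp (leftQuot 0 c) d +
      ∑ i : Fin m, shuffle (d i) (modComp (leftQuot i.succ c) d) := by
  funext ν
  rw [leftQuot, modComp_eq_wordSum, wordSum_cons _ _ _ _ (by simp [phi, oneSeries]),
    Fin.sum_univ_succ]
  simp [phi, phiLetter, leftQuot_add, leftQuot_prepend, modComp_eq_wordSum, dhat,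
    shuffle_zero_left, shuffle_wordSum (isLocallyFinite_phi d), (Fin.succ_ne_zero _).symm]

lemma leftQuot_succ_comp (c : Series m) (d : SeriesVec m m) (i : Fin m) :
    leftQuot i.succ (comp c d) = 0 := by
  funext ν
  rw [leftQuot, comp_eq_wordSum, wordSum_cons _ _ _ _ (by simp [psi, oneSeries])]
  simp [psi, psiLetter, leftQuot_prepend, wordSum_zero_right]

lemma leftQuot_zero_comp (c : Series m) (d : SeriesVec m m) :
    leftQuot 0 (comp c d) = ∑ ℓ, shuffle (dtil d ℓ) (comp (leftQuot ℓ c) d) := by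
  funext ν
  rw [leftQuot, comp_eq_wordSum, wordSum_cons _ _ _ _ (by simp [psi, oneSeries])]
  simp [psi, psiLetter, leftQuot_prepend, comp_eq_wordSum,
    shuffle_wordSum (isLocallyFinite_psi d)]

/-! ### Algebraic properties of the modified composition product -/

lemma modComp_add (c c' : Series m) (d : SeriesVec m m) :
    modComp (c + c') d = modComp c d + modComp c' d := by
  simp only [modComp_eq_wordSum, wordSum_add_left]

lemma modComp_zero (d : SeriesVec m m) : modComp 0 d = 0 := by
  simp only [modComp_eq_wordSum, wordSum_zero_left]

lemma modComp_sum {ι : Type*} (s : Finset ι) (f : ι → Series m) (d : SeriesVec m m) :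
    modComp (∑ i ∈ s, f i) d = ∑ i ∈ s, modComp (f i) d := by
  classical
  induction s using Finset.induction_on with
  | empty => simp [modComp_zero]
  | insert a s ha ih => rw [Finset.sum_insert ha, Finset.sum_insert ha, modComp_add, ih]

lemma leftQuot_oneSeries (j : Fin (m+1)) : leftQuot j (oneSeries : Series m) = 0 := by
  funext ν
  simp [leftQuot, oneSeries]

lemma modComp_oneSeries (d : SeriesVec m m) : modComp oneSeries d = oneSeries := by
  funext ν
  cases ν with
  | nil => exact modComp_nil _ _
  | cons j ν =>
    change leftQuot j (modComp oneSeries d) ν = leftQuot j oneSeries ν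
    cases j using Fin.cases with
    | zero => simp [leftQuot_zero_modComp, leftQuot_oneSeries, modComp_zero, shuffle_zero_right]
    | succ i => simp [leftQuot_succ_modComp, leftQuot_oneSeries, modComp_zero]

/-- Right modified composition `c ↦ c ∘̃ e` is a homomorphism for the shuffle product. -/
lemma modComp_shuffle (a b : Series m) (e : SeriesVec m m) :
    modComp (shuffle a b) e = shuffle (modComp a e) (modComp b e) := by
  funext ν
  induction hn : ν.length using Nat.strong_induction_on generalizing a b ν with
  | _ n ih =>
    cases ν with
    | nil => simp [modComp_nil, shuffle]
    | cons j ν =>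
      replace ih : ∀ (a b : Series m) (ξ : Word m), ξ.length ≤ ν.length →
          modComp (shuffle a b) e ξ = shuffle (modComp a e) (modComp b e) ξ :=
        fun a b ξ hξ => ih ξ.length (by simp only [List.length_cons] at hn; omega) a b ξ rfl
      change leftQuot j (modComp (shuffle a b) e) ν = _
      rw [shuffle_cons]
      cases j using Fin.cases with
      | succ i =>
        simp only [leftQuot_succ_modComp, leftQuot_shuffle, modComp_add, Pi.add_apply,
          ih _ _ ν le_rfl]
      | zero =>
        have key : ∀ (f a b : Series m), shuffle f (modComp (shuffle a b) e) ν =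
            shuffle f (shuffle (modComp a e) (modComp b e)) ν :=
          fun f a b => shuffle_congr (fun _ _ => rfl) (fun ξ hξ => ih a b ξ hξ)
        simp only [leftQuot_zero_modComp, leftQuot_shuffle, modComp_add, Pi.add_apply,
          ih _ _ ν le_rfl, shuffle_add_left, shuffle_add_right, shuffle_sum_left,
          shuffle_sum_right, Finset.sum_apply, key, Finset.sum_add_distrib, shuffle_assoc,
          shuffle_left_comm (modComp a e) (e _)]
        ring

lemma modComp_dtil (c e : SeriesVec m m) (ℓ : Fin (m+1)) :
    modComp (dtil c ℓ) e = dtil (modCompVec c e) ℓ := by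
  cases ℓ using Fin.cases with
  | zero => exact modComp_oneSeries e
  | succ i => rfl

/-- Mixed associativity: `(d ∘ c) ∘̃ e = d ∘ (c ∘̃ e)`. -/
lemma modComp_comp (d : Series m) (c e : SeriesVec m m) :
    modComp (comp d c) e = comp d (modCompVec c e) := by
  funext ν
  induction hn : ν.length using Nat.strong_induction_on generalizing d ν with
  | _ n ih =>
    cases ν with
    | nil => simp [modComp_nil, comp_nil]
    | cons j ν =>
      change leftQuot j (modComp (comp d c) e) ν = leftQuot j (comp d (modCompVec c e)) ν
      cases j using Fin.cases with
      | succ i => simp [leftQuot_succ_modComp, leftQuot_succ_comp, modComp_zero]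
      | zero =>
        simp only [leftQuot_zero_modComp, leftQuot_zero_comp, leftQuot_succ_comp, modComp_zero,
          shuffle_zero_right, Finset.sum_const_zero, add_zero, modComp_sum, modComp_shuffle,
          modComp_dtil, Finset.sum_apply]
        refine Finset.sum_congr rfl fun ℓ _ => shuffle_congr (fun _ _ => rfl) fun ξ hξ => ?_
        exact ih ξ.length (by simp only [List.length_cons] at hn; omega) _ ξ rfl

lemma modCompVec_compVec (d c e : SeriesVec m m) :
    modCompVec (compVec d c) e = compVec d (modCompVec c e) :=
  funext fun i => modComp_comp (d i) c e

/-! ### Contractivity -/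

/-- Composition is strictly contractive in its right argument. -/
lemma comp_congr {w w' : SeriesVec m m} {n : ℕ}
    (h : ∀ i, ∀ ξ : Word m, ξ.length < n → w i ξ = w' i ξ) (d : Series m)
    (ν : Word m) (hν : ν.length ≤ n) : comp d w ν = comp d w' ν := by
  induction hk : ν.length using Nat.strong_induction_on generalizing d ν with
  | _ k ih =>
    cases ν with
    | nil => simp [comp_nil]
    | cons j ν =>
      simp only [List.length_cons] at hν hk
      change leftQuot j (comp d w) ν = leftQuot j (comp d w') ν
      cases j using Fin.cases with
      | succ i => simp [leftQuot_succ_comp]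
      | zero =>
        simp only [leftQuot_zero_comp, Finset.sum_apply]
        refine Finset.sum_congr rfl fun ℓ _ => shuffle_congr (fun ξ hξ => ?_) fun ξ hξ =>
          ih ξ.length (by omega) _ ξ (by omega) rfl
        cases ℓ using Fin.cases with
        | zero => rfl
        | succ i => exact h i ξ (by omega)

/-- Modified composition is nonexpansive in its right argument. -/
lemma modComp_congr {e e' : SeriesVec m m} {n : ℕ}
    (h : ∀ i, ∀ ξ : Word m, ξ.length ≤ n → e i ξ = e' i ξ) (c : Series m)
    (ν : Word m) (hν : ν.length ≤ n) : modComp c e ν = modComp c e' ν := by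
  induction hk : ν.length using Nat.strong_induction_on generalizing c ν with
  | _ k ih =>
    cases ν with
    | nil => simp [modComp_nil]
    | cons j ν =>
      simp only [List.length_cons] at hν hk
      have ih' : ∀ (c : Series m) (ξ : Word m), ξ.length ≤ ν.length →
          modComp c e ξ = modComp c e' ξ :=
        fun c ξ hξ => ih ξ.length (by omega) c ξ (by omega) rfl
      change leftQuot j (modComp c e) ν = leftQuot j (modComp c e') ν
      cases j using Fin.cases with
      | succ i => simp only [leftQuot_succ_modComp, ih' _ ν le_rfl]
      | zero =>
        simp only [leftQuot_zero_modComp, Pi.add_apply, Finset.sum_apply, ih' _ ν le_rfl]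
        congr 1
        exact Finset.sum_congr rfl fun i _ =>
          shuffle_congr (fun ξ hξ => h i ξ (by omega)) (ih' _)

/-- The feedback equation `w = c ∘̃ (d ∘ w)` has at most one solution. -/
lemma feedback_unique {c d w w' : SeriesVec m m} (hw : w = modCompVec c (compVec d w))
    (hw' : w' = modCompVec c (compVec d w')) : w = w' := by
  have h : ∀ n : ℕ, ∀ i, ∀ ξ : Word m, ξ.length < n → w i ξ = w' i ξ := by
    intro n
    induction n with
    | zero => simp
    | succ n ih =>
      intro i ξ hξ
      rw [hw, hw']
      exact modComp_congr (fun i ξ hξ => comp_congr ih (d i) ξ hξ) (c i) ξ (by omega)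
  funext i ξ
  exact h (ξ.length + 1) i ξ (Nat.lt_succ_self _)

end FeedbackProduct

/-- if `e = (d ∘ c) ∘̃ e` (i.e. `e = (−d ∘ c)⁻¹`), then
`w := c ∘̃ e` satisfies the feedback fixed-point equation `w = c ∘̃ (d ∘ w)`;
consequently the feedback product (the unique solution of that fixed-point
equation) satisfies `c @ d = c ∘̃ (−d ∘ c)⁻¹`. -/
theorem feedbackProduct_formula (m : ℕ) (c d e : SeriesVec m m)
    (he : e = modCompVec (compVec d c) e) :
    modCompVec c e = modCompVec c (compVec d (modCompVec c e)) ∧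
    (∀ w : SeriesVec m m, w = modCompVec c (compVec d w) → w = modCompVec c e) := by
  have h : modCompVec c e = modCompVec c (compVec d (modCompVec c e)) := by
    rw [← FeedbackProduct.modCompVec_compVec, ← he]
  exact ⟨h, fun w hw => FeedbackProduct.feedback_unique hw h⟩
end
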